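/- arXiv:2306.03590 — 5 statements merged into one kernel-verified Lean document; each statement's English description precedes it below -/
import Mathlib

section
/- Suppose F ∈ 𝓔^m and 𝕃^m_+ is an open subset of S^m. Let 𝓛 ⊆ S^m be an affine subspace, A₀ ∈ 𝓛, and S_n ∈ S^m. Then a point Σ̂ in the set (S_n + 𝓛^⊥) ∩ S^m_+ minimizes Σ ↦ F(Σ) − ⟨A₀, Σ⟩ over (S_n + 𝓛^⊥) ∩ S^m_+ if and only if L̂ := ∇F(Σ̂) lies in 𝓛 ∩ 𝕃^m_+ and maximizes g_n(L) := −F*(L) + ⟨L, S_n⟩ over 𝓛 ∩ 𝕃^m_+; that is, the two optimization problems have the same (unique) solution, related by L̂ = ∇F(Σ̂). -/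
open Matrix Filter Topology

namespace Entropic

abbrev Mat (m : ℕ) := Matrix (Fin m) (Fin m) ℝ

variable {m : ℕ}

/-- The trace inner product `⟨A,B⟩ = tr(AB)` on matrices. -/
noncomputable def ip (A B : Mat m) : ℝ := (A * B).trace

/-- The Frobenius norm `‖A‖_F = √tr(AAᵀ)`. -/
noncomputable def fnorm (A : Mat m) : ℝ := Real.sqrt (ip A Aᵀ)

/-- The class `𝓔^m`: proper convex lower semicontinuous `F : S^m → ℝ ∪ {+∞}` with
`S^m_+ ⊆ dom F ⊆ cl(S^m_+)` which is strictly convex and continuously differentiable on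
`S^m_+`; the (trace-inner-product) gradient on `S^m_+` is bundled as `grad`. -/
structure EClass (m : ℕ) where
  F : Mat m → EReal
  grad : Mat m → Mat m
  F_ne_bot : ∀ A : Mat m, F A ≠ ⊥
  convex : ∀ x y : Mat m, x.IsHermitian → y.IsHermitian → ∀ a b : ℝ,
    0 ≤ a → 0 ≤ b → a + b = 1 →
    F (a • x + b • y) ≤ (a : EReal) * F x + (b : EReal) * F y
  lsc : LowerSemicontinuousOn F {A : Mat m | A.IsHermitian}
  posDef_mem_dom : ∀ A : Mat m, A.PosDef → F A ≠ ⊤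
  dom_subset_psd : ∀ A : Mat m, F A ≠ ⊤ → A.PosSemidef
  strictConvex : ∀ x y : Mat m, x.PosDef → y.PosDef → x ≠ y → ∀ a b : ℝ,
    0 < a → 0 < b → a + b = 1 →
    F (a • x + b • y) < (a : EReal) * F x + (b : EReal) * F y
  grad_isHermitian : ∀ P : Mat m, P.PosDef → (grad P).IsHermitian
  hasGradAt : ∀ P : Mat m, P.PosDef → ∀ H : Mat m, H.IsHermitian →
    HasDerivAt (fun t : ℝ => (F (P + t • H)).toReal) (ip (grad P) H) 0
  grad_continuousOn : ContinuousOn grad {A : Mat m | A.PosDef}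

/-- `𝕃^m_+ = ∇F(S^m_+)`. -/
def Lplus (E : EClass m) : Set (Mat m) := E.grad '' {A : Mat m | A.PosDef}

/-- The Fenchel conjugate `F*(L) = sup_{Σ ∈ S^m} (⟨Σ,L⟩ − F(Σ))`. -/
noncomputable def conj (E : EClass m) (L : Mat m) : EReal :=
  ⨆ S : {A : Mat m // A.IsHermitian}, ((ip (S : Mat m) L : EReal) - E.F (S : Mat m))

/-- `g_n(L) = −F*(L) + ⟨L, S_n⟩`. -/
noncomputable def gn (E : EClass m) (Sn L : Mat m) : EReal :=
  -(conj E L) + (ip L Sn : EReal)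

/-- A set `U ⊆ S^m` is (relatively) open in `S^m`. -/
def RelOpen (U : Set (Mat m)) : Prop :=
  U ⊆ {A : Mat m | A.IsHermitian} ∧
    ∀ L ∈ U, ∃ ε > 0, ∀ M : Mat m, M.IsHermitian → fnorm (M - L) < ε → M ∈ U

/-- The affine subspace `A₀ + V` of `S^m`. -/
def affSet (A0 : Mat m) (V : Submodule ℝ (Mat m)) : Set (Mat m) :=
  {L : Mat m | L - A0 ∈ V}

/-- The orthogonal complement in `S^m` (w.r.t. the trace inner product) of the linear
subspace `V`. -/
def perp (V : Submodule ℝ (Mat m)) : Set (Mat m) :=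
  {W : Mat m | W.IsHermitian ∧ ∀ U ∈ V, ip W U = 0}

lemma ip_add_right (A B C : Mat m) : ip A (B + C) = ip A B + ip A C := by
  simp [ip, Matrix.mul_add]

lemma ip_sub_right (A B C : Mat m) : ip A (B - C) = ip A B - ip A C := by
  simp [ip, Matrix.mul_sub]

lemma ip_smul_right (A B : Mat m) (t : ℝ) : ip A (t • B) = t * ip A B := by
  simp [ip]

lemma ip_comm (A B : Mat m) : ip A B = ip B A := Matrix.trace_mul_comm A B

/-- The trace inner product as a bilinear form. -/
noncomputable def ipForm (m : ℕ) : LinearMap.BilinForm ℝ (Mat m) :=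
  LinearMap.mk₂ ℝ ip
    (fun A B C => by simp [ip, Matrix.add_mul]) (fun t A B => by simp [ip])
    ip_add_right (fun t A B => ip_smul_right A B t)

lemma ipForm_apply (A B : Mat m) : ipForm m A B = ip A B := rfl

lemma eq_zero_of_ip_self {A : Mat m} (hA : A.IsHermitian) (h : ip A A = 0) : A = 0 := by
  rw [← Matrix.trace_conjTranspose_mul_self_eq_zero_iff, hA.eq]
  exact h

/-- A subspace of symmetric matrices coincides with its double orthogonal complement. -/
lemma mem_of_forall_perp {V : Submodule ℝ (Mat m)} (hV : ∀ A ∈ V, Matrix.IsHermitian A)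
    {D : Mat m} (hD : D.IsHermitian) (h : ∀ W ∈ perp V, ip D W = 0) : D ∈ V := by
  have hrefl : (ipForm m).IsRefl := fun A B hAB => by
    rw [ipForm_apply] at hAB ⊢
    rwa [ip_comm]
  have hcompl : IsCompl V ((ipForm m).orthogonal V) := by
    rw [LinearMap.BilinForm.isCompl_orthogonal_iff_disjoint hrefl, Submodule.disjoint_def]
    intro A hA hA'
    exact eq_zero_of_ip_self (hV A hA) (hA' A hA)
  have hmem : D ∈ V ⊔ (ipForm m).orthogonal V := by simp [hcompl.sup_eq_top]
  obtain ⟨v, hv, w, hw, hvw⟩ := Submodule.mem_sup.mp hmem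
  have hw_herm : w.IsHermitian := by
    rw [show w = D - v by rw [← hvw]; abel]
    exact hD.sub (hV v hv)
  have hw_perp : w ∈ perp V := ⟨hw_herm, fun U hU => (ip_comm w U).trans (hw U hU)⟩
  have hww : ip w w = 0 := by
    have h1 := h w hw_perp
    rw [← hvw, ip_comm, ip_add_right, hw_perp.2 v hv, zero_add] at h1
    exact h1
  rw [← hvw, eq_zero_of_ip_self hw_herm hww, add_zero]
  exact hv

lemma isHermitian_real_smul {W : Mat m} (hW : W.IsHermitian) (t : ℝ) :
    (t • W).IsHermitian := by
  rw [Matrix.IsHermitian, Matrix.conjTranspose_smul, hW.eq, star_trivial]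

lemma posDef_add_smul_eventually {P W : Mat m} (hP : P.PosDef) (hW : W.IsHermitian) :
    ∀ᶠ t : ℝ in 𝓝 0, (P + t • W).PosDef := by
  have hsphere : ∀ᶠ t : ℝ in 𝓝 0, ∀ x ∈ Metric.sphere (0 : Fin m → ℝ) 1,
      0 < x ⬝ᵥ ((P + t • W) *ᵥ x) := by
    refine (isCompact_sphere _ _).eventually_forall_of_forall_eventually fun x hx => ?_
    have hcont : Continuous fun z : ℝ × (Fin m → ℝ) => z.2 ⬝ᵥ ((P + z.1 • W) *ᵥ z.2) := by
      fun_prop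
    refine hcont.continuousAt.eventually (lt_mem_nhds ?_)
    have hx0 : x ≠ 0 := by
      rintro rfl
      simp at hx
    simpa using hP.dotProduct_mulVec_pos hx0
  filter_upwards [hsphere] with t ht
  refine Matrix.PosDef.of_dotProduct_mulVec_pos (hP.1.add ?_) fun x hx => ?_
  · exact isHermitian_real_smul hW t
  · have hn : 0 < ‖x‖ := norm_pos_iff.mpr hx
    have h1 := ht (‖x‖⁻¹ • x) (by simp [norm_smul, hn.ne'])
    rw [Matrix.mulVec_smul, dotProduct_smul, smul_dotProduct, smul_eq_mul, smul_eq_mul] at h1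
    have h2 : 0 < ‖x‖⁻¹ := inv_pos.mpr hn
    simpa using pos_of_mul_pos_right (pos_of_mul_pos_right h1 h2.le) h2.le

namespace EClass

lemma coe_toReal_F (E : EClass m) {Q : Mat m} (hQ : E.F Q ≠ ⊤) :
    ((E.F Q).toReal : EReal) = E.F Q :=
  EReal.coe_toReal hQ (E.F_ne_bot Q)

/-- The subgradient inequality at a positive definite matrix. -/
lemma subgradient (E : EClass m) {P Q : Mat m} (hP : P.PosDef) (hQ : Q.IsHermitian)
    (hQF : E.F Q ≠ ⊤) :
    (E.F P).toReal + ip (E.grad P) (Q - P) ≤ (E.F Q).toReal := by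
  have hlim := (E.hasGradAt P hP (Q - P) (hQ.sub hP.1)).tendsto_slope_zero_right
  have hle : ip (E.grad P) (Q - P) ≤ (E.F Q).toReal - (E.F P).toReal := by
    refine le_of_tendsto hlim ?_
    filter_upwards [Ioo_mem_nhdsGT (zero_lt_one' ℝ)] with t ht
    have hc := E.convex P Q hP.1 hQ (1 - t) t (by linarith [ht.2]) ht.1.le (by ring)
    rw [← E.coe_toReal_F hQF, ← E.coe_toReal_F (E.posDef_mem_dom P hP),
      show (1 - t) • P + t • Q = P + t • (Q - P) by module] at hc
    norm_cast at hc
    have hne : E.F (P + t • (Q - P)) ≠ ⊤ := ne_top_of_le_ne_top (EReal.coe_ne_top _) hc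
    rw [← E.coe_toReal_F hne, EReal.coe_le_coe_iff] at hc
    simp only [zero_add, zero_smul, add_zero, smul_eq_mul]
    rw [inv_mul_le_iff₀ ht.1]
    linarith
  linarith

lemma conj_grad_le (E : EClass m) {P : Mat m} (hP : P.PosDef) :
    conj E (E.grad P) ≤ ((ip P (E.grad P) - (E.F P).toReal : ℝ) : EReal) := by
  refine iSup_le fun ⟨S, hS⟩ => ?_
  by_cases hF : E.F S = ⊤
  · simp [hF]
  · have h := E.subgradient hP hS hF
    rw [ip_sub_right, ip_comm _ S, ip_comm _ P] at h
    rw [← E.coe_toReal_F hF, ← EReal.coe_sub, EReal.coe_le_coe_iff]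
    linarith

lemma le_conj (E : EClass m) {P : Mat m} (hP : P.PosDef) (L : Mat m) :
    ((ip P L - (E.F P).toReal : ℝ) : EReal) ≤ conj E L := by
  rw [EReal.coe_sub, E.coe_toReal_F (E.posDef_mem_dom P hP)]
  exact le_iSup (fun S : {A : Mat m // A.IsHermitian} =>
    ((ip (S : Mat m) L : EReal) - E.F (S : Mat m))) ⟨P, hP.1⟩

lemma gn_le (E : EClass m) {P : Mat m} (hP : P.PosDef) (Sn L : Mat m) :
    gn E Sn L ≤ (((E.F P).toReal - ip L (P - Sn) : ℝ) : EReal) := by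
  have h : gn E Sn L ≤ -((ip P L - (E.F P).toReal : ℝ) : EReal) + (ip L Sn : EReal) :=
    add_le_add_left (EReal.neg_le_neg_iff.mpr (E.le_conj hP L)) _
  refine h.trans_eq ?_
  rw [← EReal.coe_neg, ← EReal.coe_add, ip_sub_right, ip_comm P L]
  congr 1
  ring

lemma le_gn_grad (E : EClass m) {P : Mat m} (hP : P.PosDef) (Sn : Mat m) :
    (((E.F P).toReal - ip (E.grad P) (P - Sn) : ℝ) : EReal) ≤ gn E Sn (E.grad P) := by
  have h : -((ip P (E.grad P) - (E.F P).toReal : ℝ) : EReal) + (ip (E.grad P) Sn : EReal) ≤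
      gn E Sn (E.grad P) :=
    add_le_add_left (EReal.neg_le_neg_iff.mpr (E.conj_grad_le hP)) _
  refine le_trans (le_of_eq ?_) h
  rw [← EReal.coe_neg, ← EReal.coe_add, ip_sub_right, ip_comm P]
  congr 1
  ring

/-- The first-order condition for a minimizer of `F - ⟨A₀, ·⟩` among positive definite
matrices in `S_n + V^⊥`. -/
lemma ip_grad_sub_eq_zero_of_isMinOn (E : EClass m) {V : Submodule ℝ (Mat m)}
    {A0 Sn P W : Mat m} (hPn : P - Sn ∈ perp V) (hP : P.PosDef)
    (hmin : IsMinOn (fun Q : Mat m => E.F Q - (ip A0 Q : EReal))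
      {Q : Mat m | Q - Sn ∈ perp V ∧ Q.PosDef} P)
    (hW : W ∈ perp V) : ip (E.grad P - A0) W = 0 := by
  have hderiv : HasDerivAt (fun t : ℝ => (E.F (P + t • W)).toReal - (ip A0 P + t * ip A0 W))
      (ip (E.grad P) W - 1 * ip A0 W) 0 :=
    (E.hasGradAt P hP W hW.1).sub (((hasDerivAt_id (0 : ℝ)).mul_const _).const_add _)
  have hloc : IsLocalMin
      (fun t : ℝ => (E.F (P + t • W)).toReal - (ip A0 P + t * ip A0 W)) 0 := by
    filter_upwards [posDef_add_smul_eventually hP hW.1] with t ht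
    have hmem : P + t • W - Sn ∈ perp V := by
      rw [show P + t • W - Sn = (P - Sn) + t • W by abel]
      refine ⟨hPn.1.add (isHermitian_real_smul hW.1 t), fun U hU => ?_⟩
      rw [ip_comm, ip_add_right, ip_smul_right, ip_comm U, ip_comm U, hPn.2 U hU, hW.2 U hU]
      simp
    have h : E.F P - (ip A0 P : EReal) ≤ E.F (P + t • W) - (ip A0 (P + t • W) : EReal) :=
      hmin ⟨hmem, ht⟩
    rw [← E.coe_toReal_F (E.posDef_mem_dom _ hP), ← E.coe_toReal_F (E.posDef_mem_dom _ ht),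
      ← EReal.coe_sub, ← EReal.coe_sub, EReal.coe_le_coe_iff, ip_add_right, ip_smul_right] at h
    simpa using h
  have h0 := hloc.hasDerivAt_eq_zero hderiv
  rw [ip_comm, ip_sub_right, ip_comm W, ip_comm W]
  linarith

end EClass

lemma ip_eq_of_mem_affSet {V : Submodule ℝ (Mat m)} {A0 L W : Mat m}
    (hL : L ∈ affSet A0 V) (hW : W ∈ perp V) : ip L W = ip A0 W := by
  have h := hW.2 _ hL
  rw [ip_sub_right, ip_comm W, ip_comm W] at h
  linarith

/-- duality, Proposition `cor:dual`. Suppose `F ∈ 𝓔^m` and `𝕃^m_+` is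
open in `S^m`. Let `𝓛 = A₀ + V ⊆ S^m` be an affine subspace with `A₀ ∈ 𝓛` and `S_n ∈ S^m`.
A point `Σ̂ ∈ (S_n + 𝓛^⊥) ∩ S^m_+` minimizes `Σ ↦ F(Σ) − ⟨A₀,Σ⟩` over
`(S_n + 𝓛^⊥) ∩ S^m_+` iff `L̂ := ∇F(Σ̂)` lies in `𝓛 ∩ 𝕃^m_+` and maximizes
`g_n(L) = −F*(L) + ⟨L,S_n⟩` over `𝓛 ∩ 𝕃^m_+`; i.e. the two problems have the same
solution, related by `L̂ = ∇F(Σ̂)`. -/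
theorem dual_problem {m : ℕ} (E : EClass m) (hopen : RelOpen (Lplus E))
    (V : Submodule ℝ (Mat m)) (hV : ∀ A ∈ V, Matrix.IsHermitian A)
    (A0 : Mat m) (hA0 : A0.IsHermitian) (Sn : Mat m) (hSn : Sn.IsHermitian)
    (Shat : Mat m) (hShat : Shat - Sn ∈ perp V ∧ Shat.PosDef) :
    IsMinOn (fun Q : Mat m => E.F Q - (ip A0 Q : EReal))
        {Q : Mat m | Q - Sn ∈ perp V ∧ Q.PosDef} Shat ↔
      E.grad Shat ∈ affSet A0 V ∩ Lplus E ∧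
        IsMaxOn (gn E Sn) (affSet A0 V ∩ Lplus E) (E.grad Shat) := by
  constructor
  · intro hmin
    have hmem : E.grad Shat ∈ affSet A0 V :=
      mem_of_forall_perp hV ((E.grad_isHermitian _ hShat.2).sub hA0) fun W hW =>
        E.ip_grad_sub_eq_zero_of_isMinOn hShat.1 hShat.2 hmin hW
    refine ⟨⟨hmem, Set.mem_image_of_mem _ hShat.2⟩, fun L hL => ?_⟩
    have h := E.gn_le hShat.2 Sn L
    rw [ip_eq_of_mem_affSet hL.1 hShat.1, ← ip_eq_of_mem_affSet hmem hShat.1] at h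
    exact h.trans (E.le_gn_grad hShat.2 Sn)
  · rintro ⟨⟨hmem, -⟩, -⟩ Q ⟨hQn, hQ⟩
    have h := E.subgradient hShat.2 hQ.1 (E.posDef_mem_dom Q hQ)
    have h1 := ip_eq_of_mem_affSet hmem hQn
    have h2 := ip_eq_of_mem_affSet hmem hShat.1
    simp only [ip_sub_right] at h h1 h2
    change E.F Shat - (ip A0 Shat : EReal) ≤ E.F Q - (ip A0 Q : EReal)
    rw [← E.coe_toReal_F (E.posDef_mem_dom _ hShat.2), ← E.coe_toReal_F (E.posDef_mem_dom _ hQ),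
      ← EReal.coe_sub, ← EReal.coe_sub, EReal.coe_le_coe_iff]
    linarith

end Entropic
end

section
/- For every family of real numbers (c_{ij})_{1 ≤ i < j ≤ m} there exists a unique correlation matrix R, i.e., a unique positive definite symmetric m×m matrix R with R_{ii} = 1 for all i, such that the inverse matrix R^{−1} satisfies (R^{−1})_{ij} = c_{ij} for all 1 ≤ i < j ≤ m. -/
namespace Matrix

variable {n : Type*} [Fintype n]

theorem isClosed_setOf_posSemidef : IsClosed {R : Matrix n n ℝ | R.PosSemidef} := by
  simp only [posSemidef_iff_dotProduct_mulVec, Set.ofPred_and, Set.ofPred_forall]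
  refine (isClosed_eq (by fun_prop) continuous_id).inter (isClosed_iInter fun x => ?_)
  exact isClosed_le continuous_const (by fun_prop)

variable [DecidableEq n]

open scoped MatrixOrder in
theorem PosDef.exists_pos_posSemidef_sub_smul_one {R : Matrix n n ℝ} (hR : R.PosDef) :
    ∃ ε : ℝ, 0 < ε ∧ (R - ε • (1 : Matrix n n ℝ)).PosSemidef := by
  rcases isEmpty_or_nonempty n with h | h
  · refine ⟨1, one_pos, ?_⟩
    rw [Subsingleton.elim (R - _) 0]
    exact PosSemidef.zero
  · obtain ⟨r, hr, h⟩ := (CFC.exists_pos_algebraMap_le_iff (A := Matrix n n ℝ) (a := R)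
      hR.isHermitian).2 (fun x hx => by
        rw [hR.isHermitian.spectrum_real_eq_range_eigenvalues] at hx
        obtain ⟨i, rfl⟩ := hx
        exact hR.eigenvalues_pos i)
    exact ⟨r, hr, by simpa [Algebra.algebraMap_eq_smul_one, le_iff] using h⟩

theorem posSemidef_smul_one_add_smul_single_add_single {ε t : ℝ} (ht : |t| ≤ ε) {i j : n}
    (hij : i ≠ j) :
    (ε • (1 : Matrix n n ℝ) + t • (single i j 1 + single j i 1)).PosSemidef := by
  refine PosSemidef.of_dotProduct_mulVec_nonneg ?_ fun x => ?_
  · simp [IsHermitian, add_comm]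
  · have hs : x i ^ 2 + x j ^ 2 ≤ ∑ k, x k ^ 2 := by
      rw [← Finset.sum_pair (f := fun k => x k ^ 2) hij]
      exact Finset.sum_le_univ_sum_of_nonneg fun k => sq_nonneg _
    have he : star x ⬝ᵥ (ε • (1 : Matrix n n ℝ) + t • (single i j 1 + single j i 1)) *ᵥ x =
        ε * (∑ k, x k ^ 2) + 2 * t * (x i * x j) := by
      simp [add_mulVec, smul_mulVec, single_mulVec, dotProduct, Function.update_apply,
        mul_add, Finset.sum_add_distrib, Finset.mul_sum]
      simp only [mul_left_comm _ ε, ← pow_two]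
      ring
    rw [he]
    have h1 := abs_le.1 ht
    nlinarith [mul_le_mul_of_nonneg_left hs ((abs_nonneg t).trans ht),
      mul_nonneg (sub_nonneg.2 h1.1) (sq_nonneg (x i - x j)),
      mul_nonneg (sub_nonneg.2 h1.2) (sq_nonneg (x i - x j)),
      mul_nonneg (sub_nonneg.2 h1.1) (sq_nonneg (x i + x j)),
      mul_nonneg (sub_nonneg.2 h1.2) (sq_nonneg (x i + x j))]

theorem PosDef.eventually_posSemidef_add_smul {R : Matrix n n ℝ} (hR : R.PosDef) {i j : n}
    (hij : i ≠ j) :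
    ∀ᶠ t in nhds (0 : ℝ), (R + t • (single i j 1 + single j i 1)).PosSemidef := by
  obtain ⟨ε, hε, h⟩ := hR.exists_pos_posSemidef_sub_smul_one
  filter_upwards [Metric.closedBall_mem_nhds (0 : ℝ) hε] with t ht
  have ht' : |t| ≤ ε := by simpa using ht
  simpa [← add_assoc] using h.add (posSemidef_smul_one_add_smul_single_add_single ht' hij)

theorem hasDerivAt_det_one_add_smul (M : Matrix n n ℝ) :
    HasDerivAt (fun t : ℝ => det (1 + t • M)) M.trace 0 := by
  have h := (det (1 + (Polynomial.X : Polynomial ℝ) • M.map Polynomial.C)).hasDerivAt 0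
  rw [derivative_det_one_add_X_smul] at h
  refine h.congr_of_eventuallyEq (Filter.Eventually.of_forall fun t => ?_)
  simp [eval_det, ← smul_eq_mul_diagonal]

theorem hasDerivAt_det_add_smul {R : Matrix n n ℝ} (hR : IsUnit R) (M : Matrix n n ℝ) :
    HasDerivAt (fun t : ℝ => det (R + t • M)) (R.det * (R⁻¹ * M).trace) 0 := by
  refine ((hasDerivAt_det_one_add_smul (R⁻¹ * M)).const_mul R.det).congr_of_eventuallyEq
    (Filter.Eventually.of_forall fun t => ?_)
  simp only
  rw [← det_mul, mul_add, mul_one, mul_smul_comm,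
    mul_nonsing_inv_cancel_left _ _ ((isUnit_iff_isUnit_det R).1 hR)]

theorem PosSemidef.abs_apply_le_one {R : Matrix n n ℝ} (hR : R.PosSemidef)
    (hd : ∀ i, R i i = 1) (i j : n) : |R i j| ≤ 1 := by
  have hs : R j i = R i j := by simpa using hR.isHermitian.apply i j
  have h1 := hR.dotProduct_mulVec_nonneg (Pi.single i 1 + Pi.single j 1)
  have h2 := hR.dotProduct_mulVec_nonneg (Pi.single i 1 - Pi.single j 1)
  simp [add_dotProduct, sub_dotProduct, mulVec_add, mulVec_sub, hs, hd] at h1 h2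
  rw [abs_le]
  constructor <;> linarith

theorem isCompact_setOf_posSemidef_diag_eq_one :
    IsCompact {R : Matrix n n ℝ | R.PosSemidef ∧ ∀ i, R i i = 1} := by
  have hc : IsCompact (Set.pi Set.univ fun _ => Set.pi Set.univ fun _ => Set.Icc (-1) 1 :
      Set (n → n → ℝ)) :=
    isCompact_univ_pi fun _ => isCompact_univ_pi fun _ => isCompact_Icc
  refine IsCompact.of_isClosed_subset (X := n → n → ℝ) hc ?_ ?_
  · refine IsClosed.and (X := Matrix n n ℝ) isClosed_setOf_posSemidef ?_
    simp only [Set.ofPred_forall]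
    exact isClosed_iInter fun i => isClosed_eq (by fun_prop) continuous_const
  · exact fun R hR i _ j _ => abs_le.1 (hR.1.abs_apply_le_one hR.2 i j)

theorem PosDef.eq_of_inv_sub_inv_eq_diagonal {R S : Matrix n n ℝ} (hR : R.PosDef) (hS : S.PosDef)
    (hd : ∀ i, R i i = S i i) {d : n → ℝ} (h : R⁻¹ - S⁻¹ = diagonal d) : R = S := by
  have hRu := (isUnit_iff_isUnit_det R).1 hR.isUnit
  have hSu := (isUnit_iff_isUnit_det S).1 hS.isUnit
  have key : R * diagonal d * S = S - R := by
    rw [← h, mul_sub, sub_mul, mul_nonsing_inv _ hRu, one_mul, nonsing_inv_mul_cancel_right _ _ hSu]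
  have hd0 : d = 0 := by
    by_contra hne
    have hpos := (hR.hadamard hS).dotProduct_mulVec_pos hne
    have hz : star d ⬝ᵥ (R ⊙ S) *ᵥ d = 0 := by
      refine Finset.sum_eq_zero fun i _ => ?_
      have hi := congrFun (congrFun key i) i
      rw [sub_apply, hd i, sub_self, mul_apply] at hi
      rw [mul_eq_zero]
      right
      rw [← hi]
      refine Finset.sum_congr rfl fun j _ => ?_
      have hs : S j i = S i j := by simpa using hS.isHermitian.apply i j
      simp [mul_diagonal, hs]
      ring
    exact hpos.ne' hz
  subst hd0
  rw [show diagonal (0 : n → ℝ) = 0 from diagonal_zero, mul_zero, zero_mul] at key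
  exact (sub_eq_zero.1 key.symm).symm

theorem exists_posDef_diag_eq_one_inv_add_inv_eq (c : n → n → ℝ) :
    ∃ R : Matrix n n ℝ, R.PosDef ∧ (∀ i, R i i = 1) ∧
      ∀ i j, i ≠ j → R⁻¹ i j + R⁻¹ j i = c i j + c j i := by
  set L : Matrix n n ℝ → ℝ := fun R => ∑ i, ∑ j, c i j * R i j with hL
  have hLadd (A B : Matrix n n ℝ) : L (A + B) = L A + L B := by
    simp [hL, mul_add, Finset.sum_add_distrib]
  have hLsmul (t : ℝ) (A : Matrix n n ℝ) : L (t • A) = t * L A := by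
    simp [hL, Finset.mul_sum, mul_left_comm]
  have hLsingle (i j : n) : L (single i j 1) = c i j := by
    simp [hL, single_apply, ite_and]
  obtain ⟨R, ⟨hRs, hRd⟩, hmax⟩ := isCompact_setOf_posSemidef_diag_eq_one.exists_isMaxOn
    (f := fun R : Matrix n n ℝ => R.det * Real.exp (-L R))
    ⟨1, PosSemidef.one, fun i => one_apply_eq i⟩
    (Continuous.continuousOn (by fun_prop))
  have hdet : R.det ≠ 0 := by
    intro h0
    have h1 := hmax (show (1 : Matrix n n ℝ) ∈ _ from ⟨PosSemidef.one, fun i => one_apply_eq i⟩)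
    simp only [Set.mem_ofPred_eq, h0, zero_mul, det_one, one_mul] at h1
    exact absurd h1 (not_le.2 (Real.exp_pos _))
  have hR : R.PosDef := hRs.posDef_iff_det_ne_zero.2 hdet
  refine ⟨R, hR, hRd, fun i j hij => ?_⟩
  set E : Matrix n n ℝ := single i j 1 + single j i 1 with hE
  have hloc : IsLocalMax (fun t : ℝ => (R + t • E).det * Real.exp (-(L R + t * L E))) 0 := by
    filter_upwards [hR.eventually_posSemidef_add_smul hij] with t ht
    have h1 := hmax (show R + t • E ∈ _ from ⟨ht, fun k => by
      have h1 : ¬ (i = k ∧ j = k) := fun h => hij (h.1.trans h.2.symm)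
      have h2 : ¬ (j = k ∧ i = k) := fun h => h1 h.symm
      simp [hE, hRd, h1, h2]⟩)
    simpa [hLadd, hLsmul] using h1
  have hexp : HasDerivAt (fun t : ℝ => Real.exp (-(L R + t * L E)))
      (Real.exp (-(L R + 0 * L E)) * -(1 * L E)) 0 :=
    ((((hasDerivAt_id (0 : ℝ)).mul_const (L E)).const_add (L R)).neg).exp
  have hz := hloc.hasDerivAt_eq_zero ((hasDerivAt_det_add_smul hR.isUnit E).mul hexp)
  have htr : (R⁻¹ * E).trace = R⁻¹ i j + R⁻¹ j i := by
    simp [hE, mul_add, trace_mul_single, add_comm]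
  have hLE : L E = c i j + c j i := by rw [hE, hLadd, hLsingle, hLsingle]
  rw [← htr, ← hLE]
  have hf : R.det * Real.exp (-(L R + 0 * L E)) * ((R⁻¹ * E).trace - L E) = 0 := by
    rw [zero_smul, add_zero] at hz
    linear_combination hz
  exact sub_eq_zero.1 ((mul_eq_zero.1 hf).resolve_left (mul_ne_zero hdet (Real.exp_ne_zero _)))

end Matrix

/-- For every family of reals `(c_{ij})_{i<j}` there exists a unique
correlation matrix `R` (positive definite symmetric with unit diagonal) such that
`(R⁻¹)_{ij} = c_{ij}` for all `i < j`. -/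
theorem exists_unique_correlation_matrix_with_inverse_offdiag
    (m : ℕ) (c : Fin m → Fin m → ℝ) :
    ∃! R : Matrix (Fin m) (Fin m) ℝ, R.PosDef ∧ (∀ i, R i i = 1) ∧
      ∀ i j : Fin m, i < j → R⁻¹ i j = c i j := by
  obtain ⟨R, hR, hRd, hRc⟩ := Matrix.exists_posDef_diag_eq_one_inv_add_inv_eq
    (fun i j : Fin m => if i < j then 2 * c i j else 0)
  have hsymm {S : Matrix (Fin m) (Fin m) ℝ} (hS : S.PosDef) (i j) : S⁻¹ j i = S⁻¹ i j := by
    simpa using hS.inv.isHermitian.apply i j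
  have hRi (i j : Fin m) (hij : i < j) : R⁻¹ i j = c i j := by
    have h := hRc i j hij.ne
    simp only [hsymm hR i j, hij, hij.not_gt, if_true, if_false] at h
    linarith
  refine ⟨R, ⟨hR, hRd, hRi⟩, fun S ⟨hS, hSd, hSi⟩ => ?_⟩
  refine hS.eq_of_inv_sub_inv_eq_diagonal hR (fun i => by rw [hSd, hRd])
    (d := fun i => S⁻¹ i i - R⁻¹ i i) ?_
  ext i j
  rcases lt_trichotomy i j with h | rfl | h
  · simp [Matrix.diagonal_apply_ne _ h.ne, hSi i j h, hRi i j h]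
  · simp
  · simp [Matrix.diagonal_apply_ne _ h.ne', hsymm hS j i, hsymm hR j i, hSi j i h, hRi j i h]
end

section
/- Suppose F ∈ 𝓔^m and 𝕃^m_+ is open. Let G be a graph on vertices {1,…,m} with edge set E, and let 𝓛_G := {L ∈ S^m : L_{ij} = 0 whenever i ≠ j and ij ∉ E}. Let S ∈ S^m. Then L̂ ∈ 𝓛_G ∩ 𝕃^m_+ maximizes g(L) := −F*(L) + ⟨L, S⟩ over 𝓛_G ∩ 𝕃^m_+ if and only if Σ̂ := ∇F*(L̂) satisfies Σ̂_{ii} = S_{ii} for all i and Σ̂_{ij} = S_{ij} for all edges ij ∈ E; equivalently, Σ̂ is the minimizer of F(Σ) over all Σ ∈ S^m_+ agreeing with S on the diagonal and on the entries indexed by E. -/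
open Matrix Filter Topology

namespace Entropic

variable {m : ℕ}

section Pairing

lemma ip_add_left (A B C : Mat m) : ip (A + B) C = ip A C + ip B C := by
  simp [ip, Matrix.add_mul]

lemma ip_smul_left (A B : Mat m) (t : ℝ) : ip (t • A) B = t * ip A B := by
  simp [ip]

lemma ip_eq_sum (A B : Mat m) : ip A B = ∑ i, ∑ j, A i j * B j i := by
  simp [ip, Matrix.trace, Matrix.mul_apply]

lemma ip_single_left (i j : Fin m) (A : Mat m) : ip (Matrix.single i j 1) A = A j i := by
  simp [ip, Matrix.trace_single_mul]

lemma continuous_ip_right (A : Mat m) : Continuous (ip A) := by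
  unfold ip
  fun_prop

lemma tendsto_fnorm_smul (H : Mat m) :
    Tendsto (fun t : ℝ => fnorm (t • H)) (𝓝 0) (𝓝 0) := by
  have hc : Continuous fun t : ℝ => fnorm (t • H) := by
    have h : (fun t : ℝ => fnorm (t • H)) = fun t : ℝ => Real.sqrt (t * (t * ip H Hᵀ)) := by
      funext t
      rw [fnorm, Matrix.transpose_smul, ip_smul_left, ip_smul_right]
    rw [h]
    fun_prop
  simpa [fnorm, ip] using hc.tendsto 0

end Pairing

lemma isHermitian_add_smul {A B : Mat m} (hA : A.IsHermitian) (hB : B.IsHermitian) (t : ℝ) :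
    (A + t • B).IsHermitian := by
  rw [Matrix.IsHermitian, Matrix.conjTranspose_add, Matrix.conjTranspose_smul, hA, hB,
    star_trivial]

namespace EClass

variable (E : EClass m)

/-- The real-valued version of `F`, meaningful on the effective domain. -/
noncomputable def f (A : Mat m) : ℝ := (E.F A).toReal

lemma coe_f {A : Mat m} (hA : E.F A ≠ ⊤) : ((E.f A : ℝ) : EReal) = E.F A :=
  EReal.coe_toReal hA (E.F_ne_bot A)

lemma F_segment_le {A B : Mat m} (hA : A.IsHermitian) (hB : B.IsHermitian)
    (hFA : E.F A ≠ ⊤) (hFB : E.F B ≠ ⊤) {t : ℝ} (h0 : 0 ≤ t) (h1 : t ≤ 1) :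
    E.F (A + t • (B - A)) ≤ ((E.f A + t * (E.f B - E.f A) : ℝ) : EReal) := by
  have h := E.convex A B hA hB (1 - t) t (by linarith) h0 (by ring)
  rw [← E.coe_f hFA, ← E.coe_f hFB] at h
  have e1 : (1 - t) • A + t • B = A + t • (B - A) := by module
  have e2 : E.f A + t * (E.f B - E.f A) = (1 - t) * E.f A + t * E.f B := by ring
  rw [e1] at h
  rw [e2]
  exact_mod_cast h

lemma segment_ne_top {A B : Mat m} (hA : A.IsHermitian) (hB : B.IsHermitian)
    (hFA : E.F A ≠ ⊤) (hFB : E.F B ≠ ⊤) {t : ℝ} (h0 : 0 ≤ t) (h1 : t ≤ 1) :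
    E.F (A + t • (B - A)) ≠ ⊤ :=
  ((E.F_segment_le hA hB hFA hFB h0 h1).trans_lt (EReal.coe_lt_top _)).ne

lemma f_segment_le {A B : Mat m} (hA : A.IsHermitian) (hB : B.IsHermitian)
    (hFA : E.F A ≠ ⊤) (hFB : E.F B ≠ ⊤) {t : ℝ} (h0 : 0 ≤ t) (h1 : t ≤ 1) :
    E.f (A + t • (B - A)) ≤ E.f A + t * (E.f B - E.f A) := by
  have h := E.F_segment_le hA hB hFA hFB h0 h1
  rw [← E.coe_f (E.segment_ne_top hA hB hFA hFB h0 h1)] at h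
  exact_mod_cast h

/-- The gradient inequality. -/
lemma f_add_ip_grad_le {P Q : Mat m} (hP : P.PosDef) (hQ : Q.IsHermitian) (hFQ : E.F Q ≠ ⊤) :
    E.f P + ip (E.grad P) (Q - P) ≤ E.f Q := by
  have hd := (E.hasGradAt P hP (Q - P) (hQ.sub hP.1)).tendsto_slope_zero_right
  have hle : ip (E.grad P) (Q - P) ≤ E.f Q - E.f P := by
    refine le_of_tendsto hd ?_
    filter_upwards [Ioo_mem_nhdsGT (zero_lt_one (α := ℝ))] with t ht
    have h := E.f_segment_le hP.1 hQ (E.posDef_mem_dom P hP) hFQ ht.1.le ht.2.le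
    simp only [zero_add, zero_smul, add_zero, smul_eq_mul]
    rw [inv_mul_le_iff₀ ht.1]
    unfold f at *
    linarith
  linarith

/-- The strict gradient inequality, valid on the whole effective domain. -/
lemma f_add_ip_grad_lt {P Q : Mat m} (hP : P.PosDef) (hQ : Q.IsHermitian) (hFQ : E.F Q ≠ ⊤)
    (hne : Q ≠ P) : E.f P + ip (E.grad P) (Q - P) < E.f Q := by
  have hFP := E.posDef_mem_dom P hP
  set M : Mat m := P + (1 / 2 : ℝ) • (Q - P) with hM
  have hMeq : M = (1 / 2 : ℝ) • P + (1 / 2 : ℝ) • Q := by rw [hM]; module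
  have hMP : M.PosDef := by
    rw [hMeq]
    exact (hP.smul (by norm_num)).add_posSemidef
      ((E.dom_subset_psd Q hFQ).smul (by norm_num))
  have hMsub : M - P = (1 / 2 : ℝ) • (Q - P) := by rw [hM]; module
  have hMne : P ≠ M := by
    intro h
    rw [← h, sub_self, eq_comm, smul_eq_zero, sub_eq_zero] at hMsub
    exact hMsub.elim (by norm_num) hne
  have h1 := E.f_segment_le hP.1 hQ hFP hFQ (t := 1 / 2) (by norm_num) (by norm_num)
  rw [← hM] at h1
  have hFM := E.posDef_mem_dom M hMP
  have h2 := E.strictConvex P M hP hMP hMne (1 / 2) (1 / 2) (by norm_num) (by norm_num)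
    (by norm_num)
  have hNeq : (1 / 2 : ℝ) • P + (1 / 2 : ℝ) • M = P + (1 / 2 : ℝ) • (M - P) := by module
  have hFN := E.segment_ne_top hP.1 hMP.1 hFP hFM (t := 1 / 2) (by norm_num) (by norm_num)
  rw [hNeq, ← E.coe_f hFP, ← E.coe_f hFM, ← E.coe_f hFN] at h2
  have h2' : E.f (P + (1 / 2 : ℝ) • (M - P)) < 1 / 2 * E.f P + 1 / 2 * E.f M := by
    exact_mod_cast h2
  have h3 := E.f_add_ip_grad_le hP (isHermitian_add_smul hP.1 (hMP.1.sub hP.1) (1 / 2)) hFN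
  rw [add_sub_cancel_left, hMsub, ip_smul_right, ip_smul_right] at h3
  rw [hMsub] at h2'
  linarith

lemma coe_le_conj (L : Mat m) {Q : Mat m} (hQ : Q.PosDef) :
    ((ip Q L - E.f Q : ℝ) : EReal) ≤ conj E L := by
  have h := le_iSup (fun S : {A : Mat m // A.IsHermitian} =>
    ((ip (S : Mat m) L : EReal) - E.F (S : Mat m))) ⟨Q, hQ.1⟩
  rw [EReal.coe_sub, E.coe_f (E.posDef_mem_dom Q hQ)]
  exact h

lemma conj_grad {Q : Mat m} (hQ : Q.PosDef) :
    conj E (E.grad Q) = ((ip Q (E.grad Q) - E.f Q : ℝ) : EReal) := by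
  refine le_antisymm (iSup_le ?_) (E.coe_le_conj _ hQ)
  rintro ⟨A, hA⟩
  by_cases hFA : E.F A = ⊤
  · simp [hFA]
  · have h := E.f_add_ip_grad_le hQ hA hFA
    rw [ip_sub_right, ip_comm _ A, ip_comm _ Q] at h
    simp only
    rw [← E.coe_f hFA, ← EReal.coe_sub]
    exact_mod_cast by linarith

lemma gn_grad (S : Mat m) {Q : Mat m} (hQ : Q.PosDef) :
    gn E S (E.grad Q) = ((E.f Q - ip Q (E.grad Q) + ip (E.grad Q) S : ℝ) : EReal) := by
  rw [gn, E.conj_grad hQ, ← EReal.coe_neg, ← EReal.coe_add]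
  congr 1
  ring

section Norm

attribute [local instance] Matrix.normedAddCommGroup Matrix.normedSpace

lemma exists_abs_ip_le (H : Mat m) : ∃ C > 0, ∀ B : Mat m, |ip H B| ≤ C * ‖B‖ := by
  let φ : Mat m →ₗ[ℝ] ℝ :=
    { toFun := ip H
      map_add' := ip_add_right H
      map_smul' := fun t B => ip_smul_right H B t }
  obtain ⟨C, hC, h⟩ := (LinearMap.toContinuousLinearMap φ).bound
  exact ⟨C, hC, h⟩

/-- `F` grows uniformly above its tangent on a small sphere. -/
lemma exists_gap {P : Mat m} (hP : P.PosDef) (r : ℝ) (hr : 0 < r) :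
    ∃ c > 0, ∀ A : Mat m, A.IsHermitian → E.F A ≠ ⊤ → ‖A - P‖ = r →
      c < E.f A - ip (E.grad P) (A - P) - E.f P := by
  set K : Set (Mat m) := {A | A.IsHermitian} ∩ Metric.sphere P r with hK
  have hKc : IsCompact K := by
    refine (isCompact_sphere P r).inter_left ?_
    exact isClosed_eq (by fun_prop) continuous_id
  set h : Mat m → EReal := fun A => E.F A + ((-ip (E.grad P) (A - P) - E.f P : ℝ) : EReal) with hh
  have hreal : ∀ A, E.F A ≠ ⊤ →
      h A = ((E.f A - ip (E.grad P) (A - P) - E.f P : ℝ) : EReal) := by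
    intro A hA
    simp only [hh]
    rw [← E.coe_f hA, ← EReal.coe_add]
    congr 1
    ring
  have hlsc : LowerSemicontinuousOn h K := by
    refine LowerSemicontinuousOn.add' (E.lsc.mono Set.inter_subset_left) ?_ ?_
    · refine Continuous.lowerSemicontinuous ?_ |>.lowerSemicontinuousOn _
      refine continuous_coe_real_ereal.comp ?_
      exact ((((continuous_ip_right _).comp (continuous_id.sub continuous_const))).neg).sub
        continuous_const
    · intro A _
      exact EReal.continuousAt_add (Or.inr (EReal.coe_ne_bot _)) (Or.inr (EReal.coe_ne_top _))
  have hpos : ∀ A ∈ K, 0 < h A := by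
    rintro A ⟨hA, hAr⟩
    by_cases hFA : E.F A = ⊤
    · simp only [hh, hFA]
      rw [EReal.top_add_coe]
      exact EReal.zero_lt_top
    · rw [hreal A hFA]
      have hne : A ≠ P := by
        rintro rfl
        simp at hAr
        exact hr.ne hAr
      have := E.f_add_ip_grad_lt hP hA hFA hne
      exact_mod_cast by linarith
  rcases K.eq_empty_or_nonempty with hemp | hne
  · refine ⟨1, one_pos, fun A hA _ hAr => ?_⟩
    have : A ∈ K := ⟨hA, by rw [mem_sphere_iff_norm, hAr]⟩
    rw [hemp] at this
    exact this.elim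
  · obtain ⟨A₀, hA₀, hmin⟩ := hlsc.exists_isMinOn hne hKc
    obtain ⟨c, hc0, hc⟩ := EReal.lt_iff_exists_real_btwn.1 (hpos A₀ hA₀)
    refine ⟨c, by exact_mod_cast hc0, fun A hA hFA hAr => ?_⟩
    have h1 := hc.trans_le (hmin (show A ∈ K from ⟨hA, by rw [mem_sphere_iff_norm, hAr]⟩))
    rw [hreal A hFA] at h1
    exact_mod_cast h1

/-- The inverse of the gradient map is continuous along lines. -/
lemma eventually_norm_sub_le {P : Mat m} (hP : P.PosDef) (H : Mat m) {r : ℝ} (hr : 0 < r) :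
    ∀ᶠ t : ℝ in 𝓝[>] 0, ∀ Q : Mat m, Q.PosDef → E.grad Q = E.grad P + t • H →
      ‖Q - P‖ ≤ r := by
  obtain ⟨c, hc, hgap⟩ := E.exists_gap hP r hr
  obtain ⟨C, hC, hbound⟩ := exists_abs_ip_le H
  have hlt : 0 < c / (C * r) := by positivity
  filter_upwards [Ioo_mem_nhdsGT hlt] with t ht Q hQ hgrad
  by_contra! hfar
  have hn : 0 < ‖Q - P‖ := hr.trans hfar
  set s : ℝ := r / ‖Q - P‖ with hs
  have hs0 : 0 < s := by positivity
  have hs1 : s ≤ 1 := (div_le_one hn).2 hfar.le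
  have hsn : s * ‖Q - P‖ = r := div_mul_cancel₀ _ hn.ne'
  have hFP := E.posDef_mem_dom P hP
  have hFQ := E.posDef_mem_dom Q hQ
  have h1 := hgap (P + s • (Q - P)) (isHermitian_add_smul hP.1 (hQ.1.sub hP.1) s)
    (E.segment_ne_top hP.1 hQ.1 hFP hFQ hs0.le hs1)
    (by rw [add_sub_cancel_left, norm_smul, Real.norm_of_nonneg hs0.le, hsn])
  have h2 := E.f_segment_le hP.1 hQ.1 hFP hFQ hs0.le hs1
  have h3 := E.f_add_ip_grad_le hQ hP.1 hFP
  rw [hgrad, ip_add_left, ip_smul_left, ← neg_sub Q P, ← neg_one_smul ℝ (Q - P), ip_smul_right,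
    ip_smul_right] at h3
  rw [add_sub_cancel_left, ip_smul_right] at h1
  have h4 : ip H (Q - P) ≤ C * ‖Q - P‖ := (le_abs_self _).trans (hbound _)
  have h5 : E.f Q - E.f P - ip (E.grad P) (Q - P) ≤ t * (C * ‖Q - P‖) := by
    have := mul_le_mul_of_nonneg_left h4 ht.1.le
    linarith
  have h6 := mul_le_mul_of_nonneg_left h5 hs0.le
  have h7 : s * (t * (C * ‖Q - P‖)) = t * (C * r) := by rw [← hsn]; ring
  have h8 : t * (C * r) < c := (lt_div_iff₀ (by positivity)).1 ht.2
  linarith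

/-- First-order optimality in a feasible direction. -/
lemma ip_le_of_isMaxOn (hopen : RelOpen (Lplus E)) (S : Mat m) {V : Set (Mat m)} {P : Mat m}
    (hP : P.PosDef) (hmax : IsMaxOn (gn E S) (V ∩ Lplus E) (E.grad P)) {H : Mat m}
    (hH : H.IsHermitian) (hV : ∀ t : ℝ, E.grad P + t • H ∈ V) : ip H S ≤ ip H P := by
  obtain ⟨C, hC, hbound⟩ := exists_abs_ip_le H
  obtain ⟨ε, hε, hball⟩ := hopen.2 (E.grad P) ⟨P, hP, rfl⟩
  refine le_of_forall_pos_le_add fun δ hδ => ?_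
  have hev : ∀ᶠ t : ℝ in 𝓝[>] 0, fnorm (t • H) < ε :=
    ((tendsto_fnorm_smul H).eventually_lt_const hε).filter_mono nhdsWithin_le_nhds
  obtain ⟨t, ⟨hclose, hsmall⟩, ht⟩ :=
    (((E.eventually_norm_sub_le hP H (r := δ / C) (by positivity)).and hev).and
      self_mem_nhdsWithin).exists
  have ht : 0 < t := ht
  have hmem : E.grad P + t • H ∈ Lplus E :=
    hball _ (isHermitian_add_smul (E.grad_isHermitian P hP) hH t)
      (by rwa [add_sub_cancel_left])
  obtain ⟨Q, hQ, hgrad⟩ := id hmem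
  have hQ : Q.PosDef := hQ
  have hnorm := hclose Q hQ hgrad
  have h1 : gn E S (E.grad P + t • H) ≤ gn E S (E.grad P) := hmax ⟨hV t, hmem⟩
  rw [← hgrad, E.gn_grad S hQ, E.gn_grad S hP, EReal.coe_le_coe_iff, hgrad] at h1
  have h2 := E.f_add_ip_grad_le hP hQ.1 (E.posDef_mem_dom Q hQ)
  rw [ip_sub_right, ip_comm _ Q, ip_comm _ P] at h2
  rw [ip_add_right, ip_add_left, ip_smul_right, ip_smul_left, ip_comm Q H] at h1
  have h3 : t * ip H S ≤ t * ip H Q := by linarith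
  have h4 : ip H S ≤ ip H Q := le_of_mul_le_mul_left h3 ht
  have h5 := (le_abs_self _).trans (hbound (Q - P))
  have h6 : C * ‖Q - P‖ ≤ δ :=
    (mul_le_mul_of_nonneg_left hnorm hC.le).trans (mul_div_cancel₀ δ hC.ne').le
  rw [ip_sub_right] at h5
  linarith

end Norm

lemma ip_eq_of_isMaxOn (hopen : RelOpen (Lplus E)) (S : Mat m) {V : Set (Mat m)} {P : Mat m}
    (hP : P.PosDef) (hmax : IsMaxOn (gn E S) (V ∩ Lplus E) (E.grad P)) {H : Mat m}
    (hH : H.IsHermitian) (hV : ∀ t : ℝ, E.grad P + t • H ∈ V) : ip H P = ip H S := by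
  have h1 := E.ip_le_of_isMaxOn hopen S hP hmax hH hV
  have h2 := E.ip_le_of_isMaxOn hopen S hP hmax hH.neg fun t => by
    simpa using hV (-t)
  rw [← neg_one_smul ℝ H, ip_smul_left, ip_smul_left] at h2
  linarith

end EClass

/-- A matrix supported on the diagonal and the edges pairs equally with matrices agreeing
there. -/
lemma ip_eq_of_agree {e : Fin m → Fin m → Prop} (he : ∀ i j, e i j ↔ e j i) {L A B : Mat m}
    (hL : ∀ i j : Fin m, i ≠ j → ¬ e i j → L i j = 0) (hd : ∀ i, A i i = B i i)
    (hedge : ∀ i j, e i j → A i j = B i j) : ip L A = ip L B := by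
  rw [ip_eq_sum, ip_eq_sum]
  refine Finset.sum_congr rfl fun i _ => Finset.sum_congr rfl fun j _ => ?_
  by_cases hij : i = j
  · rw [hij, hd]
  by_cases hE : e i j
  · rw [hedge j i ((he i j).1 hE)]
  · rw [hL i j hij hE, zero_mul, zero_mul]

/-- Proposition `prop:sparsedual`. Suppose `F ∈ 𝓔^m` and `𝕃^m_+` is
open in `S^m`. Let `G` be a graph on `{1,…,m}` with (symmetric) edge relation `e`, and let
`𝓛_G = {L ∈ S^m : L_{ij} = 0 if i ≠ j and ij ∉ E}`. For `S ∈ S^m` and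
`L̂ ∈ 𝓛_G ∩ 𝕃^m_+` with `Σ̂ := ∇F*(L̂)` (the unique `P ∈ S^m_+` with `∇F(P) = L̂`):
`L̂` maximizes `g(L) = −F*(L) + ⟨L,S⟩` over `𝓛_G ∩ 𝕃^m_+` iff `Σ̂` agrees with `S` on
the diagonal and on all edges; equivalently, iff `Σ̂` minimizes `F` over all positive
definite matrices agreeing with `S` on the diagonal and the edges. -/
theorem sparse_dual {m : ℕ} (E : EClass m) (hopen : RelOpen (Lplus E))
    (e : Fin m → Fin m → Prop) (he : ∀ i j, e i j ↔ e j i)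
    (S : Mat m) (hS : S.IsHermitian)
    (LG : Set (Mat m))
    (hLG : LG = {L : Mat m | L.IsHermitian ∧ ∀ i j : Fin m, i ≠ j → ¬ e i j → L i j = 0})
    (Lhat : Mat m) (hLhat : Lhat ∈ LG ∩ Lplus E)
    (P : Mat m) (hP : P.PosDef) (hPL : E.grad P = Lhat) :
    (IsMaxOn (gn E S) (LG ∩ Lplus E) Lhat ↔
      (∀ i : Fin m, P i i = S i i) ∧ ∀ i j : Fin m, e i j → P i j = S i j) ∧
    (IsMaxOn (gn E S) (LG ∩ Lplus E) Lhat ↔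
      ((∀ i : Fin m, P i i = S i i) ∧ (∀ i j : Fin m, e i j → P i j = S i j)) ∧
        IsMinOn E.F {Q : Mat m | Q.PosDef ∧ (∀ i : Fin m, Q i i = S i i) ∧
          ∀ i j : Fin m, e i j → Q i j = S i j} P) := by
  subst hPL
  have hL : ∀ i j : Fin m, i ≠ j → ¬ e i j → E.grad P i j = 0 := by
    have h := hLhat.1
    rw [hLG] at h
    exact h.2
  have hfwd : IsMaxOn (gn E S) (LG ∩ Lplus E) (E.grad P) →
      (∀ i : Fin m, P i i = S i i) ∧ ∀ i j : Fin m, e i j → P i j = S i j := by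
    intro hmax
    refine ⟨fun i => ?_, fun i j hij => ?_⟩
    · have hH : (Matrix.single i i (1 : ℝ)).IsHermitian := by
        simp [Matrix.IsHermitian]
      have h := E.ip_eq_of_isMaxOn hopen S hP hmax hH fun t => by
        rw [hLG]
        refine ⟨isHermitian_add_smul (E.grad_isHermitian P hP) hH t, fun k l hkl hE => ?_⟩
        have hne : ¬ (i = k ∧ i = l) := fun h => hkl (h.1.symm.trans h.2)
        simp [hL k l hkl hE, hne]
      rwa [ip_single_left, ip_single_left] at h
    · have hH : (Matrix.single i j (1 : ℝ) + Matrix.single j i 1).IsHermitian := by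
        simp [Matrix.IsHermitian, add_comm]
      have h := E.ip_eq_of_isMaxOn hopen S hP hmax hH fun t => by
        rw [hLG]
        refine ⟨isHermitian_add_smul (E.grad_isHermitian P hP) hH t, fun k l hkl hE => ?_⟩
        have hne : ¬ (i = k ∧ j = l) := by
          rintro ⟨rfl, rfl⟩
          exact hE hij
        have hne' : ¬ (j = k ∧ i = l) := by
          rintro ⟨rfl, rfl⟩
          exact hE ((he _ _).1 hij)
        simp [hL k l hkl hE, hne, hne']
      simp only [ip_add_left, ip_single_left] at h
      have hPs : P j i = P i j := by simpa using hP.1.apply i j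
      have hSs : S j i = S i j := by simpa using hS.apply i j
      linarith
  have hbwd : ((∀ i : Fin m, P i i = S i i) ∧ ∀ i j : Fin m, e i j → P i j = S i j) →
      IsMaxOn (gn E S) (LG ∩ Lplus E) (E.grad P) := by
    rintro ⟨hd, hedge⟩ L ⟨hLmem, Q, hQ, rfl⟩
    have hQ : Q.PosDef := hQ
    rw [hLG] at hLmem
    have h1 := ip_eq_of_agree he hL hd hedge
    have h2 := ip_eq_of_agree he hLmem.2 hd hedge
    have h3 := E.f_add_ip_grad_le hQ hP.1 (E.posDef_mem_dom P hP)
    rw [ip_sub_right, ip_comm _ Q] at h3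
    change gn E S (E.grad Q) ≤ gn E S (E.grad P)
    rw [E.gn_grad S hQ, E.gn_grad S hP, EReal.coe_le_coe_iff, ip_comm P]
    linarith
  refine ⟨⟨hfwd, hbwd⟩, fun hmax => ⟨hfwd hmax, ?_⟩, fun h => hbwd h.1⟩
  rintro Q ⟨hQ, hQd, hQedge⟩
  obtain ⟨hd, hedge⟩ := hfwd hmax
  have h1 := ip_eq_of_agree he hL (fun i => (hQd i).trans (hd i).symm)
    fun i j hij => (hQedge i j hij).trans (hedge i j hij).symm
  have hFQ := E.posDef_mem_dom Q hQ
  have h2 := E.f_add_ip_grad_le hP hQ.1 hFQ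
  rw [ip_sub_right, h1] at h2
  change E.F P ≤ E.F Q
  rw [← E.coe_f (E.posDef_mem_dom P hP), ← E.coe_f hFQ, EReal.coe_le_coe_iff]
  linarith

end Entropic
end

section
/- Suppose F ∈ 𝓔^m has the form F(Σ) = tr(φ(Σ)) on S^m_+, where φ is analytic on (0,+∞) and φ(Σ) denotes the matrix function obtained by applying φ to the eigenvalues in a spectral decomposition of Σ. Let 𝓛 ⊆ S^m be a linear subspace that is a Jordan algebra, i.e., (AB + BA)/2 ∈ 𝓛 for all A, B ∈ 𝓛, and suppose the identity matrix I_m ∈ 𝓛. Then for every Σ ∈ S^m_+: Σ ∈ 𝓛 if and only if ∇F(Σ) = φ'(Σ) ∈ 𝓛. -/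
open Matrix Filter Topology

namespace Entropic

variable {m : ℕ}

/-- The matrix function `ψ(Σ) = U ψ(Λ) Uᵀ` obtained by applying `ψ : ℝ → ℝ` to the
eigenvalues in a spectral decomposition of a symmetric matrix. -/
noncomputable def matApply {m : ℕ} (ψ : ℝ → ℝ) (P : Mat m) : Mat m :=
  if h : P.IsHermitian then
    (h.eigenvectorUnitary : Mat m) * Matrix.diagonal (fun i => ψ (h.eigenvalues i)) *
      star (h.eigenvectorUnitary : Mat m)
  else 0

theorem matApply_eq_cfc (ψ : ℝ → ℝ) {P : Mat m} (hP : P.IsHermitian) :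
    matApply ψ P = cfc ψ P := by
  rw [hP.cfc_eq, Matrix.IsHermitian.cfc, Unitary.conjStarAlgAut_apply, matApply, dif_pos hP]
  rfl

/-- A unital Jordan algebra is closed under powers. -/
theorem pow_mem_of_jordan {L : Submodule ℝ (Mat m)}
    (hJordan : ∀ A B : Mat m, A ∈ L → B ∈ L → ((1 : ℝ) / 2) • (A * B + B * A) ∈ L)
    (hI : (1 : Mat m) ∈ L) {A : Mat m} (hA : A ∈ L) (n : ℕ) : A ^ n ∈ L := by
  induction n with
  | zero => simpa using hI
  | succ n ih =>
    have h := hJordan _ _ ih hA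
    rwa [← pow_succ, ← pow_succ', ← two_smul ℝ, smul_smul, one_div,
      inv_mul_cancel₀ two_ne_zero, one_smul] at h

theorem aeval_mem_of_jordan {L : Submodule ℝ (Mat m)}
    (hJordan : ∀ A B : Mat m, A ∈ L → B ∈ L → ((1 : ℝ) / 2) • (A * B + B * A) ∈ L)
    (hI : (1 : Mat m) ∈ L) {A : Mat m} (hA : A ∈ L) (p : Polynomial ℝ) :
    Polynomial.aeval A p ∈ L := by
  rw [Polynomial.aeval_eq_sum_range]
  exact Submodule.sum_mem _ fun i _ => L.smul_mem _ (pow_mem_of_jordan hJordan hI hA i)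

/-- A unital Jordan algebra is closed under the functional calculus of its symmetric elements. -/
theorem cfc_mem_of_jordan {L : Submodule ℝ (Mat m)}
    (hJordan : ∀ A B : Mat m, A ∈ L → B ∈ L → ((1 : ℝ) / 2) • (A * B + B * A) ∈ L)
    (hI : (1 : Mat m) ∈ L) {A : Mat m} (hA : A ∈ L) (hAsym : A.IsHermitian) (ψ : ℝ → ℝ) :
    cfc ψ A ∈ L := by
  have hsa : IsSelfAdjoint A := hAsym
  set s := (Matrix.finite_spectrum A).toFinset
  have hp : (spectrum ℝ A).EqOn ψ (Lagrange.interpolate s id ψ).eval := fun x hx =>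
    (Lagrange.eval_interpolate_at_node (s := s) (v := id) ψ Function.injective_id.injOn
      ((Matrix.finite_spectrum A).mem_toFinset.mpr hx)).symm
  rw [cfc_congr hp, cfc_polynomial _ A hsa]
  exact aeval_mem_of_jordan hJordan hI hA _

theorem trace_matApply_smul_one (ψ : ℝ → ℝ) (t : ℝ) :
    (matApply ψ (t • (1 : Mat m))).trace = m * ψ t := by
  have h : (t • (1 : Mat m)).IsHermitian := by
    simp [Matrix.IsHermitian]
  rw [matApply_eq_cfc ψ h, ← Algebra.algebraMap_eq_smul_one, cfc_algebraMap,
    Algebra.algebraMap_eq_smul_one, Matrix.trace_smul, Matrix.trace_one]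
  simp [mul_comm]

/-- A spectral function of class `𝓔^m`, `m ≥ 1`, is induced by a strictly convex function. -/
theorem strictConvexOn_of_trace_matApply [NeZero m] (E : EClass m) {φ : ℝ → ℝ}
    (hF : ∀ P : Mat m, P.PosDef → E.F P = ((matApply φ P).trace : EReal)) :
    StrictConvexOn ℝ (Set.Ioi 0) φ := by
  have hpd : ∀ t : ℝ, 0 < t → (t • (1 : Mat m)).PosDef := fun t ht => Matrix.PosDef.one.smul ht
  have hFt : ∀ t : ℝ, 0 < t → E.F (t • (1 : Mat m)) = ((m * φ t : ℝ) : EReal) := fun t ht => by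
    rw [hF _ (hpd t ht), trace_matApply_smul_one]
  refine ⟨convex_Ioi 0, fun x hx y hy hxy a b ha hb hab => ?_⟩
  have hne : x • (1 : Mat m) ≠ y • 1 := fun h => hxy (smul_left_injective ℝ one_ne_zero h)
  have h := E.strictConvex _ _ (hpd x hx) (hpd y hy) hne a b ha hb hab
  rw [smul_smul, smul_smul, ← add_smul, hFt x hx, hFt y hy,
    hFt _ (add_pos (mul_pos ha hx) (mul_pos hb hy))] at h
  norm_cast at h
  have hm : (0 : ℝ) < m := Nat.cast_pos.mpr (NeZero.pos m)
  simp only [smul_eq_mul]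
  refine lt_of_mul_lt_mul_left ?_ hm.le
  linarith

theorem spectrum_subset_Ioi {P : Mat m} (hP : P.PosDef) : spectrum ℝ P ⊆ Set.Ioi 0 := by
  rw [hP.isHermitian.spectrum_real_eq_range_eigenvalues]
  rintro _ ⟨i, rfl⟩
  exact hP.eigenvalues_pos i

/-- Proposition `prop:jordan`. Suppose `F ∈ 𝓔^m` has the form
`F(Σ) = tr(φ(Σ))` on `S^m_+` with `φ` analytic on `(0,∞)` and gradient
`∇F(Σ) = φ'(Σ)`. If `𝓛 ⊆ S^m` is a linear subspace which is a Jordan algebra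
(`(AB+BA)/2 ∈ 𝓛` for `A,B ∈ 𝓛`) containing `I_m`, then for every `Σ ∈ S^m_+`:
`Σ ∈ 𝓛` iff `∇F(Σ) = φ'(Σ) ∈ 𝓛`. -/
theorem jordan_algebra_grad_mem_iff {m : ℕ} (E : EClass m) (φ : ℝ → ℝ)
    (hφ : AnalyticOnNhd ℝ φ (Set.Ioi 0))
    (hF : ∀ P : Mat m, P.PosDef → E.F P = ((matApply φ P).trace : EReal))
    (hgrad : ∀ P : Mat m, P.PosDef → E.grad P = matApply (deriv φ) P)
    (L : Submodule ℝ (Mat m)) (hLsym : ∀ A ∈ L, Matrix.IsHermitian A)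
    (hJordan : ∀ A B : Mat m, A ∈ L → B ∈ L → ((1 : ℝ) / 2) • (A * B + B * A) ∈ L)
    (hI : (1 : Mat m) ∈ L) :
    ∀ P : Mat m, P.PosDef → (P ∈ L ↔ E.grad P ∈ L) := by
  intro P hP
  have hPsym := hP.isHermitian
  rw [hgrad P hP, matApply_eq_cfc _ hPsym]
  refine ⟨fun h => cfc_mem_of_jordan hJordan hI h hPsym _, fun h => ?_⟩
  rcases Nat.eq_zero_or_pos m with rfl | hm
  · rw [Subsingleton.elim P 0]
    exact L.zero_mem
  have : NeZero m := ⟨hm.ne'⟩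
  have hinj : Set.InjOn (deriv φ) (Set.Ioi 0) :=
    ((strictConvexOn_of_trace_matApply E hF).strictMonoOn_deriv
      fun x hx => (hφ x hx).differentiableAt).injOn
  set g := Function.invFunOn (deriv φ) (Set.Ioi 0)
  have hsa : IsSelfAdjoint P := hPsym
  have hfin := Matrix.finite_spectrum P
  have hg : cfc g (cfc (deriv φ) P) = P := by
    rw [← cfc_comp g (deriv φ) P hsa ((hfin.image _).continuousOn _) (hfin.continuousOn _)]
    exact (cfc_congr fun x hx => hinj.leftInvOn_invFunOn (spectrum_subset_Ioi hP hx)).trans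
      (cfc_id ℝ P hsa)
  rw [← hg]
  exact cfc_mem_of_jordan hJordan hI h (hLsym _ h) g

end Entropic
end

section
/- Let λ > 0. The map Σ ↦ λΣ − Σ^{−1} is a bijection from the cone S^m_+ of positive definite symmetric m×m matrices onto the space S^m of all symmetric m×m matrices; i.e., for every symmetric matrix L there exists a unique positive definite Σ with λΣ − Σ^{−1} = L. -/
open Matrix

/-- The trace form `D ↦ tr (D P D Q)` is nonnegative on symmetric matrices. -/
lemma trace_mul_mul_mul_nonneg {n : Type*} [Fintype n] [DecidableEq n] {D P Q : Matrix n n ℝ}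
    (hD : D.IsSymm) (hP : P.PosSemidef) (hQ : Q.PosSemidef) :
    0 ≤ (D * P * D * Q).trace := by
  obtain ⟨B, rfl⟩ : ∃ B, Q = Bᴴ * B := by
    open scoped MatrixOrder in
    exact CStarAlgebra.nonneg_iff_eq_star_mul_self.mp hQ.nonneg
  have hDB : (B * D)ᴴ = D * Bᴴ := by
    rw [conjTranspose_mul, conjTranspose_eq_transpose_of_trivial D, hD.eq]
  have h := (hP.mul_mul_conjTranspose_same (B * D)).trace_nonneg
  rw [hDB] at h
  rw [← mul_assoc (D * P * D), trace_mul_comm]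
  simpa only [mul_assoc] using h

lemma smul_sub_inv_injOn_posDef {n : Type*} [Fintype n] [DecidableEq n] {lam : ℝ}
    (hlam : 0 ≤ lam) :
    Set.InjOn (fun P : Matrix n n ℝ ↦ lam • P - P⁻¹) {P | P.PosDef} := by
  intro P hP Q hQ h
  have hP' : IsUnit P.det := (isUnit_iff_isUnit_det P).mp hP.isUnit
  have hQ' : IsUnit Q.det := (isUnit_iff_isUnit_det Q).mp hQ.isUnit
  have hD : (P - Q).IsSymm := by
    simpa using hP.isHermitian.sub hQ.isHermitian
  have h1 : lam • (P * (P - Q) * Q) = -(P - Q) := by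
    have h2 : lam • (P - Q) = P⁻¹ - Q⁻¹ := by
      rw [smul_sub]
      exact sub_eq_sub_iff_sub_eq_sub.mp h
    calc lam • (P * (P - Q) * Q) = P * (lam • (P - Q)) * Q := by simp
      _ = P * P⁻¹ * Q - P * (Q⁻¹ * Q) := by rw [h2]; noncomm_ring
      _ = -(P - Q) := by rw [mul_nonsing_inv _ hP', nonsing_inv_mul _ hQ']; simp
  have h3 := mul_nonneg hlam (trace_mul_mul_mul_nonneg hD hP.posSemidef hQ.posSemidef)
  have h4 : lam * ((P - Q) * P * (P - Q) * Q).trace = -((P - Q)ᴴ * (P - Q)).trace := by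
    rw [conjTranspose_eq_transpose_of_trivial, hD.eq, ← smul_eq_mul, ← trace_smul, ← trace_neg,
      ← mul_neg, ← h1, mul_smul_comm]
    simp only [mul_assoc]
  have h5 := (posSemidef_conjTranspose_mul_self (P - Q)).trace_nonneg
  exact sub_eq_zero.mp (trace_conjTranspose_mul_self_eq_zero_iff.mp (by linarith))

lemma exists_pos_mul_sub_inv_eq {lam : ℝ} (hlam : 0 < lam) (l : ℝ) :
    ∃ x : ℝ, 0 < x ∧ lam * x - x⁻¹ = l := by
  have hs : √(l ^ 2 + 4 * lam) ^ 2 = l ^ 2 + 4 * lam := Real.sq_sqrt (by positivity)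
  have hpos : 0 < l + √(l ^ 2 + 4 * lam) := by
    have : |l| < √(l ^ 2 + 4 * lam) := Real.lt_sqrt_of_sq_lt (by rw [sq_abs]; linarith)
    linarith [neg_abs_le l]
  refine ⟨(l + √(l ^ 2 + 4 * lam)) / (2 * lam), by positivity, ?_⟩
  have hne := hpos.ne'
  generalize √(l ^ 2 + 4 * lam) = s at *
  field_simp
  linear_combination hs

lemma exists_posDef_smul_sub_inv_eq {n : Type*} [Fintype n] [DecidableEq n] {lam : ℝ}
    (hlam : 0 < lam) {L : Matrix n n ℝ} (hL : L.IsHermitian) :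
    ∃ P : Matrix n n ℝ, P.PosDef ∧ lam • P - P⁻¹ = L := by
  choose d hd hdl using fun i ↦ exists_pos_mul_sub_inv_eq hlam (hL.eigenvalues i)
  let U := hL.eigenvectorUnitary
  let φ := Unitary.conjStarAlgAut ℝ (Matrix n n ℝ) U
  have hinv : (φ (diagonal d))⁻¹ = φ (diagonal d⁻¹) := by
    refine inv_eq_right_inv ?_
    rw [← map_mul, diagonal_mul_diagonal, ← map_one φ, ← diagonal_one]
    congr 2
    ext i
    exact mul_inv_cancel₀ (hd i).ne'
  refine ⟨φ (diagonal d), ?_, ?_⟩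
  · rw [Unitary.conjStarAlgAut_apply]
    exact (IsUnit.posDef_star_right_conjugate_iff (Unitary.toUnits U).isUnit).mpr
      (PosDef.diagonal hd)
  · rw [hinv, ← map_smul, ← map_sub, hL.spectral_theorem]
    congr 1
    rw [← diagonal_smul, diagonal_sub]
    congr 1
    ext i
    exact hdl i

/-- Proposition `prop:E`. For `λ > 0` the map `Σ ↦ λΣ − Σ⁻¹` is a
bijection from the cone of positive definite symmetric `m×m` matrices onto the space of
all symmetric `m×m` matrices: it takes symmetric values, and for every symmetric `L` there
is a unique positive definite `Σ` with `λΣ − Σ⁻¹ = L`. -/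
theorem smul_sub_inv_bijection (m : ℕ) (lam : ℝ) (hlam : 0 < lam) :
    (∀ P : Matrix (Fin m) (Fin m) ℝ, P.PosDef → (lam • P - P⁻¹).IsSymm) ∧
    ∀ L : Matrix (Fin m) (Fin m) ℝ, L.IsSymm →
      ∃! P : Matrix (Fin m) (Fin m) ℝ, P.PosDef ∧ lam • P - P⁻¹ = L := by
  refine ⟨fun P hP ↦ ?_, fun L hL ↦ ?_⟩
  · rw [← isHermitian_iff_isSymm]
    exact (hP.isHermitian.smul (IsSelfAdjoint.all lam)).sub hP.inv.isHermitian
  · obtain ⟨P, hP, hPL⟩ := exists_posDef_smul_sub_inv_eq hlam (isHermitian_iff_isSymm.mpr hL)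
    exact ⟨P, ⟨hP, hPL⟩, fun Q hQ ↦
      smul_sub_inv_injOn_posDef hlam.le hQ.1 hP (hQ.2.trans hPL.symm)⟩
end
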